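/- arXiv:2507.13543 — 2 statements merged into one kernel-verified Lean document; each statement's English description precedes it below -/
import Mathlib

section
/- Let 𝒮 be a nonempty finite set of models, Comp : 𝒮 → ℝ and Loss : 𝒮 → ℝ. Define the model structure function h(α) = min { Loss(S) : S ∈ 𝒮, Comp(S) ≤ α } for each α in the range of Comp, and the free energy F(λ) = min_{S ∈ 𝒮} (λ·Comp(S) + Loss(S)). Then for every λ ≥ 0, F(λ) = min_{α ∈ Comp(𝒮)} (λ·α + h(α)). -/
/-- **Legendre–Fenchel duality, first identity.**
Let `𝒮` be a nonempty finite set of models with complexity `Comp : 𝒮 → ℝ` and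
loss `Loss : 𝒮 → ℝ`.  For `α` in the range of `Comp`, the model structure function is
`h α = min {Loss S : Comp S ≤ α}`, and the free energy is
`F λ = min_{S} (λ * Comp S + Loss S)`.  Then for every `λ ≥ 0`,
`F λ = min_{α ∈ Comp(𝒮)} (λ * α + h α)`. -/
theorem free_energy_eq_min_structure {𝒮 : Type*} [Fintype 𝒮] [Nonempty 𝒮]
    (Comp Loss : 𝒮 → ℝ) (lam : ℝ) (hlam : 0 ≤ lam) :
    (Finset.univ.inf' Finset.univ_nonempty fun S => lam * Comp S + Loss S) =
      (Finset.univ.image Comp).attach.inf'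
        (Finset.attach_nonempty_iff.mpr
          (Finset.image_nonempty.mpr Finset.univ_nonempty))
        (fun α =>
          lam * (α : ℝ) +
            (Finset.univ.filter fun S => Comp S ≤ (α : ℝ)).inf'
              (by
                obtain ⟨S, -, hS⟩ := Finset.mem_image.mp α.2
                exact ⟨S, Finset.mem_filter.mpr ⟨Finset.mem_univ S, le_of_eq hS⟩⟩)
              Loss) := by
  apply le_antisymm
  · refine Finset.le_inf' _ _ fun α _ => ?_
    obtain ⟨S, hS, hS_min⟩ := Finset.exists_mem_eq_inf'
      (s := Finset.univ.filter fun S => Comp S ≤ (α : ℝ))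
      (by
        obtain ⟨S, -, hS⟩ := Finset.mem_image.mp α.2
        exact ⟨S, Finset.mem_filter.mpr ⟨Finset.mem_univ S, le_of_eq hS⟩⟩) Loss
    rw [hS_min]
    refine (Finset.inf'_le _ (Finset.mem_univ S)).trans ?_
    have hComp : Comp S ≤ α := (Finset.mem_filter.mp hS).2
    gcongr
  · refine Finset.le_inf' _ _ fun S _ => ?_
    refine (Finset.inf'_le _ (Finset.mem_attach _
      ⟨Comp S, Finset.mem_image_of_mem Comp (Finset.mem_univ S)⟩)).trans ?_
    exact add_le_add le_rfl
      (Finset.inf'_le Loss (Finset.mem_filter.mpr ⟨Finset.mem_univ S, le_refl (Comp S)⟩))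
end

section
/- Let φ : ℝ → EReal be a proper, convex, lower semicontinuous function that is nonincreasing, satisfies φ(α) = +∞ for all α < 0, and is bounded below by 0. Define F(λ) = ⨅_{α ∈ ℝ} (λ·α + φ(α)) for λ ≥ 0. Then for every α ∈ ℝ, φ(α) = ⨆_{λ ≥ 0} (F(λ) − λ·α). -/
open scoped BigOperators

/-- A convex, lower semicontinuous, nonincreasing and nonnegative function lying strictly above the
real level `c` at `a` is minorized by a nonincreasing affine function with value `c` at `a`. -/
theorem exists_nonneg_slope_affine_le {φ : ℝ → EReal}
    (hconv : ∀ x y t : ℝ, 0 ≤ t → t ≤ 1 →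
      φ (t * x + (1 - t) * y) ≤ (t : EReal) * φ x + ((1 - t : ℝ) : EReal) * φ y)
    (hlsc : LowerSemicontinuous φ) (hanti : Antitone φ) (hnonneg : ∀ x : ℝ, 0 ≤ φ x)
    {a c : ℝ} (hc : (c : EReal) < φ a) :
    ∃ l : ℝ, 0 ≤ l ∧ ∀ x : ℝ, ((c + l * (a - x) : ℝ) : EReal) ≤ φ x := by
  obtain ⟨δ, hδ, hball⟩ := Metric.eventually_nhds_iff.1 (hlsc a c hc)
  have hnear : ∀ y, a < y → y < a + δ → (c : EReal) < φ y := fun y hy hy' =>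
    hball (by rw [Real.dist_eq, abs_lt]; constructor <;> linarith)
  let S : Set ℝ := insert 0 {q | ∃ y r : ℝ, a < y ∧ φ y = r ∧ q = (c - r) / (y - a)}
  have hbdd : BddAbove S := by
    refine ⟨|c| / δ, ?_⟩
    rintro q (rfl | ⟨y, r, hy, hr, rfl⟩)
    · positivity
    have hya : 0 < y - a := sub_pos.2 hy
    by_cases hyδ : y < a + δ
    · have h := hnear y hy hyδ
      rw [hr, EReal.coe_lt_coe_iff] at h
      exact (div_nonpos_of_nonpos_of_nonneg (by linarith) hya.le).trans (by positivity)
    · have h := hnonneg y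
      rw [hr, EReal.coe_nonneg] at h
      exact div_le_div₀ (abs_nonneg c) (by linarith [le_abs_self c]) hδ (by linarith)
  refine ⟨sSup S, le_csSup hbdd (Set.mem_insert _ _), fun x => ?_⟩
  induction hx : φ x with
  | bot => exact absurd (hnonneg x) (by simp [hx])
  | top => exact le_top
  | coe r =>
    rw [EReal.coe_le_coe_iff]
    rcases lt_trichotomy x a with hxa | rfl | hxa
    · have hax : 0 < a - x := sub_pos.2 hxa
      have hS : sSup S ≤ (r - c) / (a - x) := by
        refine csSup_le ⟨0, Set.mem_insert _ _⟩ ?_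
        rintro q (rfl | ⟨y, s, hy, hs, rfl⟩)
        · have h := hc.trans_le (hanti hxa.le)
          rw [hx, EReal.coe_lt_coe_iff] at h
          exact div_nonneg (by linarith) hax.le
        · have hya : 0 < y - a := sub_pos.2 hy
          have hyx : 0 < y - x := by linarith
          have h := hconv x y ((y - a) / (y - x)) (by positivity)
            ((div_le_one hyx).2 (by linarith))
          have hcomb : (y - a) / (y - x) * x + (1 - (y - a) / (y - x)) * y = a := by
            field_simp
            ring
          rw [hcomb, hx, hs] at h
          have h' : c < (y - a) / (y - x) * r + (1 - (y - a) / (y - x)) * s := by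
            exact_mod_cast hc.trans_le h
          have hweights : (y - a) / (y - x) * r + (1 - (y - a) / (y - x)) * s
              = ((y - a) * r + (a - x) * s) / (y - x) := by
            field_simp
            ring
          rw [hweights, lt_div_iff₀ hyx] at h'
          rw [div_le_div_iff₀ hya hax]
          nlinarith
      rw [le_div_iff₀ hax] at hS
      linarith
    · rw [hx, EReal.coe_lt_coe_iff] at hc
      linarith
    · have hS : (c - r) / (x - a) ≤ sSup S :=
        le_csSup hbdd (Set.mem_insert_of_mem _ ⟨x, r, hxa, hx, rfl⟩)
      rw [div_le_iff₀ (sub_pos.2 hxa)] at hS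
      linarith

/-- **Legendre–Fenchel duality, second identity.**
Let `φ : ℝ → EReal` be proper (never `⊥`, not identically `⊤`), convex,
lower semicontinuous, nonincreasing, equal to `⊤` on negatives and bounded
below by `0`.  With the free energy `F λ = ⨅ α, (λ*α + φ α)`, we recover
`φ α = ⨆ (λ ≥ 0), (F λ - λ*α)` for every real `α`. -/
theorem structure_eq_sup_free_energy (φ : ℝ → EReal)
    (hproper_bot : ∀ α : ℝ, φ α ≠ ⊥)
    (hproper_top : ∃ α : ℝ, φ α ≠ ⊤)
    (hconv : ∀ x y t : ℝ, 0 ≤ t → t ≤ 1 →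
      φ (t * x + (1 - t) * y) ≤ (t : EReal) * φ x + ((1 - t : ℝ) : EReal) * φ y)
    (hlsc : LowerSemicontinuous φ)
    (hanti : Antitone φ)
    (hneg : ∀ α : ℝ, α < 0 → φ α = ⊤)
    (hnonneg : ∀ α : ℝ, 0 ≤ φ α)
    (F : ℝ → EReal)
    (hF : ∀ lam : ℝ, F lam = ⨅ α : ℝ, (((lam * α : ℝ) : EReal) + φ α)) :
    ∀ α : ℝ, φ α = ⨆ lam : {l : ℝ // 0 ≤ l}, (F (lam : ℝ) - (((lam : ℝ) * α : ℝ) : EReal)) := by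
  intro α
  apply le_antisymm
  · refine EReal.ge_of_forall_gt_iff_ge.1 fun c hc => ?_
    obtain ⟨l, hl, hle⟩ := exists_nonneg_slope_affine_le hconv hlsc hanti hnonneg hc
    refine le_iSup_of_le ⟨l, hl⟩ ?_
    rw [EReal.le_sub_iff_add_le (.inl (EReal.coe_ne_bot _)) (.inl (EReal.coe_ne_top _)), hF]
    refine le_iInf fun x => ?_
    have hsplit : (c : EReal) + ((l * α : ℝ) : EReal)
        = ((l * x : ℝ) : EReal) + ((c + l * (α - x) : ℝ) : EReal) := by
      rw [← EReal.coe_add, ← EReal.coe_add]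
      congr 1
      ring
    rw [hsplit]
    gcongr
    exact hle x
  · refine iSup_le fun lam => EReal.sub_le_of_le_add ?_
    rw [hF, add_comm]
    exact iInf_le _ α
end
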